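/- Let f : C → C be a homeomorphism of the Cantor ternary set such that every orbit of f is dense in C, every orbit of f⁻¹ is dense in C, and f × f : C² → C² has a dense orbit. Let X be the quotient space obtained from C × [0,1] by identifying, for each p ∈ C, the point (p,1) with (f(p),0), let φ : C×[0,1] → X be the quotient map and σ = φ × φ. Fix δ with 0 < δ < 1/10. Define V₁ = {((p,s),(q,t)) ∈ (C×[0,1])² : |p−q| < δ and |t−s| < δ}, V₂ = {((p,s),(q,t)) ∈ (C×[0,1])² : |p−f(q)| < δ, s < δ and 1−δ < t}, V₃ = {((p,s),(q,t)) ∈ (C×[0,1])² : |f(p)−q| < δ, t < δ and 1−δ < s}, V₀ = V₁ ∪ V₂ ∪ V₃, and K = (C×[0,1])² \ V₀. Then σ(K) is a compact connected subset of X². -/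

import Mathlib

open Set

noncomputable section

/-- The Cantor ternary set, as a topological (metric) space. -/
abbrev CantorT : Type := ↥cantorSet

/-- The unit interval `[0,1]` as a subspace of `ℝ`. -/
abbrev UnitI : Type := ↥(Set.Icc (0:ℝ) 1)

/-- The product `C × [0,1]`. -/
abbrev CI : Type := CantorT × UnitI

/-- `V₁ = {((p,s),(q,t)) : |p−q| < δ and |t−s| < δ}`. -/
def V1 (δ : ℝ) : Set (CI × CI) :=
  {z | |(z.1.1 : ℝ) - (z.2.1 : ℝ)| < δ ∧ |(z.2.2 : ℝ) - (z.1.2 : ℝ)| < δ}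

/-- `V₂ = {((p,s),(q,t)) : |p−f(q)| < δ, s < δ and 1−δ < t}`. -/
def V2 (f : CantorT → CantorT) (δ : ℝ) : Set (CI × CI) :=
  {z | |(z.1.1 : ℝ) - (f z.2.1 : ℝ)| < δ ∧ (z.1.2 : ℝ) < δ ∧ 1 - δ < (z.2.2 : ℝ)}

/-- `V₃ = {((p,s),(q,t)) : |f(p)−q| < δ, t < δ and 1−δ < s}`. -/
def V3 (f : CantorT → CantorT) (δ : ℝ) : Set (CI × CI) :=
  {z | |(f z.1.1 : ℝ) - (z.2.1 : ℝ)| < δ ∧ (z.2.2 : ℝ) < δ ∧ 1 - δ < (z.1.2 : ℝ)}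

/-- `V₀ = V₁ ∪ V₂ ∪ V₃`. -/
def V0 (f : CantorT → CantorT) (δ : ℝ) : Set (CI × CI) := V1 δ ∪ V2 f δ ∪ V3 f δ

/-- `K = (C×[0,1])² \ V₀`. -/
def Kset (f : CantorT → CantorT) (δ : ℝ) : Set (CI × CI) := (V0 f δ)ᶜ

/-- The identification relation on `C × [0,1]`: the point `(p,1)` is glued to `(f p, 0)`. -/
def glueRel (f : CantorT → CantorT) (a b : CI) : Prop :=
  (a.2 : ℝ) = 1 ∧ b.1 = f a.1 ∧ (b.2 : ℝ) = 0

/-- The quotient space `X` obtained from `C × [0,1]` by identifying `(p,1)` with `(f p, 0)`,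
with the quotient topology. -/
abbrev GlueSpace (f : CantorT → CantorT) : Type := Quot (glueRel f)

/-- The quotient map `φ : C × [0,1] → X`. -/
def glueMap (f : CantorT → CantorT) : CI → GlueSpace f := Quot.mk (glueRel f)

/-- The map `σ = φ × φ : (C × [0,1])² → X²`. -/
def sigmaMap (f : CantorT → CantorT) : CI × CI → GlueSpace f × GlueSpace f :=
  Prod.map (glueMap f) (glueMap f)

/-- The fibre point over `(p,q)` with heights `(s,t)`. -/
def fibPt (p q : CantorT) (s t : UnitI) : CI × CI := ((p, s), (q, t))

theorem fib_mem (f : CantorT → CantorT) (δ : ℝ) (p q : CantorT) (s t : UnitI)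
    (h1 : δ ≤ |(p : ℝ) - q| ∨ δ ≤ |(t : ℝ) - s|)
    (h2 : δ ≤ |(p : ℝ) - f q| ∨ δ ≤ (s : ℝ) ∨ (t : ℝ) ≤ 1 - δ)
    (h3 : δ ≤ |(f p : ℝ) - q| ∨ δ ≤ (t : ℝ) ∨ (s : ℝ) ≤ 1 - δ) :
    fibPt p q s t ∈ Kset f δ := by
  simp only [Kset, V0, V1, V2, V3, fibPt, mem_compl_iff, mem_union, mem_ofPred_eq]
  rintro ((⟨a, b⟩ | ⟨a, b, c⟩) | ⟨a, b, c⟩)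
  · rcases h1 with h | h <;> linarith
  · rcases h2 with h | h | h <;> linarith
  · rcases h3 with h | h | h <;> linarith

theorem fib_mem' (f : CantorT → CantorT) (δ : ℝ) (p q : CantorT) (s t : UnitI)
    (h : fibPt p q s t ∈ Kset f δ) :
    (δ ≤ |(p : ℝ) - q| ∨ δ ≤ |(t : ℝ) - s|) ∧
    (δ ≤ |(p : ℝ) - f q| ∨ δ ≤ (s : ℝ) ∨ (t : ℝ) ≤ 1 - δ) ∧
    (δ ≤ |(f p : ℝ) - q| ∨ δ ≤ (t : ℝ) ∨ (s : ℝ) ≤ 1 - δ) := by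
  simp only [Kset, V0, V1, V2, V3, fibPt, mem_compl_iff, mem_union, mem_ofPred_eq, not_or,
    not_and_or, not_lt] at h
  tauto

/-- The convex combination in the unit interval. -/
def seg (s s' u : UnitI) : UnitI :=
  ⟨(1 - (u : ℝ)) * s + u * s', by
    obtain ⟨s, hs0, hs1⟩ := s
    obtain ⟨s', hs0', hs1'⟩ := s'
    obtain ⟨u, hu0, hu1⟩ := u
    constructor
    · simp only
      have := mul_nonneg (sub_nonneg.2 hu1) hs0
      have := mul_nonneg hu0 hs0'
      linarith
    · simp only
      nlinarith [mul_nonneg (sub_nonneg.2 hu1) (sub_nonneg.2 hs1),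
        mul_nonneg hu0 (sub_nonneg.2 hs1')]⟩

theorem seg_cont (s s' : UnitI) : Continuous (seg s s') := by
  unfold seg
  fun_prop

/-- Two points of a convex set of heights contained in `K` are not separated. -/
theorem seg_const (f : CantorT → CantorT) (δ : ℝ) (k : Kset f δ → Bool) (hk : Continuous k)
    (p q : CantorT) (R : Set (ℝ × ℝ)) (hR : Convex ℝ R)
    (hRK : ∀ s t : UnitI, ((s : ℝ), (t : ℝ)) ∈ R → fibPt p q s t ∈ Kset f δ)
    (s t s' t' : UnitI) (h : ((s : ℝ), (t : ℝ)) ∈ R) (h' : ((s' : ℝ), (t' : ℝ)) ∈ R) :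
    k ⟨_, hRK s t h⟩ = k ⟨_, hRK s' t' h'⟩ := by
  have key : ∀ u : UnitI, ((seg s s' u : ℝ), (seg t t' u : ℝ)) ∈ R := by
    intro u
    have := hR h h' (sub_nonneg.2 u.2.2) u.2.1 (by ring)
    simpa [seg] using this
  have hc : Continuous (fun u : UnitI =>
      k ⟨fibPt p q (seg s s' u) (seg t t' u), hRK _ _ (key u)⟩) := by
    apply hk.comp
    apply Continuous.subtype_mk
    have h1 := seg_cont s s'
    have h2 := seg_cont t t'
    unfold fibPt
    fun_prop
  have hps : PreconnectedSpace UnitI := isPreconnected_iff_preconnectedSpace.1 isPreconnected_Icc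
  have := hps.constant hc (x := ⟨0, by simp⟩) (y := ⟨1, by simp⟩)
  simpa [seg] using this

theorem fib_A (f : CantorT → CantorT) (δ : ℝ) (hδ : 0 < δ) (hδ' : δ < 1/10)
    (p q : CantorT) (s t : UnitI) (h : (s : ℝ) + 1/2 ≤ t) (h' : δ ≤ (s : ℝ)) :
    fibPt p q s t ∈ Kset f δ := by
  have := t.2.1
  have := s.2.1
  apply fib_mem
  · right; rw [le_abs]; left; linarith
  · right; left; linarith
  · right; left; linarith

theorem fib_B (f : CantorT → CantorT) (δ : ℝ) (hδ : 0 < δ) (hδ' : δ < 1/10)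
    (p q : CantorT) (s t : UnitI) (h : (t : ℝ) + 1/2 ≤ s) (h' : (s : ℝ) ≤ 1 - δ) :
    fibPt p q s t ∈ Kset f δ := by
  have := t.2.1
  have := s.2.1
  apply fib_mem
  · right; rw [le_abs]; right; linarith
  · right; left; linarith
  · right; right; linarith

/-- One quarter. -/
def qI : UnitI := ⟨1/4, by norm_num, by norm_num⟩
/-- One half. -/
def hI : UnitI := ⟨1/2, by norm_num, by norm_num⟩
/-- Three quarters. -/
def tI : UnitI := ⟨3/4, by norm_num, by norm_num⟩
/-- Zero. -/
def zI : UnitI := ⟨0, by norm_num, by norm_num⟩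
/-- One. -/
def oI : UnitI := ⟨1, by norm_num, by norm_num⟩

/-- The region above the diagonal, with the condition making it convex. -/
theorem convexReg (a b c d e g : ℝ) (a' b' c' : ℝ) : Convex ℝ
    {x : ℝ × ℝ | a * x.1 + b * x.2 ≤ c ∧ d * x.1 + e * x.2 ≤ g ∧ a' * x.1 + b' * x.2 ≤ c'} := by
  rintro ⟨x1, x2⟩ ⟨hx, hx', hx''⟩ ⟨y1, y2⟩ ⟨hy, hy', hy''⟩ u v hu hv huv
  simp only [Prod.smul_mk, smul_eq_mul, Prod.mk_add_mk, mem_ofPred_eq] at *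
  have hu' : u = 1 - v := by linarith
  subst hu'
  refine ⟨?_, ?_, ?_⟩
  · nlinarith [mul_le_mul_of_nonneg_left hx hu, mul_le_mul_of_nonneg_left hy hv]
  · nlinarith [mul_le_mul_of_nonneg_left hx' hu, mul_le_mul_of_nonneg_left hy' hv]
  · nlinarith [mul_le_mul_of_nonneg_left hx'' hu, mul_le_mul_of_nonneg_left hy'' hv]

theorem upper_const (f : CantorT → CantorT) (δ : ℝ) (hδ : 0 < δ) (hδ' : δ < 1/10)
    (k : Kset f δ → Bool) (hk : Continuous k) (p q : CantorT) (s t : UnitI)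
    (hK : fibPt p q s t ∈ Kset f δ) (hA : fibPt p q qI tI ∈ Kset f δ)
    (hst : (s : ℝ) + δ ≤ t ∨ (δ ≤ |(p : ℝ) - q| ∧ (s : ℝ) - δ ≤ t)) :
    k ⟨_, hK⟩ = k ⟨_, hA⟩ := by
  obtain ⟨-, h2, -⟩ := fib_mem' f δ p q s t hK
  have hq : (qI : ℝ) = 1/4 := rfl
  have ht : (tI : ℝ) = 3/4 := rfl
  -- the constant in the strip condition
  obtain ⟨m, hm, hm1, hm2⟩ : ∃ m : ℝ, (s : ℝ) - t ≤ m ∧ m ≤ δ ∧ -δ ≤ m ∧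
      (δ ≤ |(p : ℝ) - q| ∨ m = -δ) := by
    rcases hst with h | ⟨h, h'⟩
    · exact ⟨-δ, by linarith, by linarith, le_refl _, Or.inr rfl⟩
    · exact ⟨δ, by linarith, by linarith, by linarith, Or.inl h⟩
  obtain ⟨hm2, hm3⟩ := hm2
  have c1 : ∀ s t : UnitI, (s : ℝ) - t ≤ m → δ ≤ |(p : ℝ) - q| ∨ δ ≤ |(t : ℝ) - s| := by
    intro s t h
    rcases hm3 with h' | h'
    · exact Or.inl h'
    · right; rw [le_abs]; left; linarith
  have c3 : ∀ s t : UnitI, (s : ℝ) - t ≤ m →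
      δ ≤ |(f p : ℝ) - q| ∨ δ ≤ (t : ℝ) ∨ (s : ℝ) ≤ 1 - δ := by
    intro s t h
    right
    by_contra! hc
    linarith [hc.1, hc.2]
  rcases h2 with h2 | h2 | h2
  · exact seg_const f δ k hk p q _ (convexReg 1 (-1) m 0 0 0 0 0 0)
      (fun s t h => fib_mem f δ p q s t (c1 s t (by simpa [sub_eq_add_neg] using h.1)) (Or.inl h2)
        (c3 s t (by simpa [sub_eq_add_neg] using h.1))) s t qI tI
      ⟨by simp only; linarith, by simp, by simp⟩ ⟨by simp only; linarith, by simp, by simp⟩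
  · exact seg_const f δ k hk p q _ (convexReg 1 (-1) m (-1) 0 (-δ) 0 0 0)
      (fun s t h => fib_mem f δ p q s t (c1 s t (by simpa [sub_eq_add_neg] using h.1))
        (Or.inr (Or.inl (by simpa using h.2.1)))
        (c3 s t (by simpa [sub_eq_add_neg] using h.1))) s t qI tI
      ⟨by simp only; linarith, by simp only; linarith, by simp⟩
      ⟨by simp only; linarith, by simp only; linarith, by simp⟩
  · exact seg_const f δ k hk p q _ (convexReg 1 (-1) m 0 1 (1-δ) 0 0 0)
      (fun s t h => fib_mem f δ p q s t (c1 s t (by simpa [sub_eq_add_neg] using h.1))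
        (Or.inr (Or.inr (by simpa using h.2.1)))
        (c3 s t (by simpa [sub_eq_add_neg] using h.1))) s t qI tI
      ⟨by simp only; linarith, by simp only; linarith, by simp⟩
      ⟨by simp only; linarith, by simp only; linarith, by simp⟩

theorem lower_const (f : CantorT → CantorT) (δ : ℝ) (hδ : 0 < δ) (hδ' : δ < 1/10)
    (k : Kset f δ → Bool) (hk : Continuous k) (p q : CantorT) (s t : UnitI)
    (hK : fibPt p q s t ∈ Kset f δ) (hB : fibPt p q tI qI ∈ Kset f δ)
    (hst : (t : ℝ) + δ ≤ s) :
    k ⟨_, hK⟩ = k ⟨_, hB⟩ := by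
  obtain ⟨-, -, h2⟩ := fib_mem' f δ p q s t hK
  have hq : (qI : ℝ) = 1/4 := rfl
  have ht : (tI : ℝ) = 3/4 := rfl
  have c1 : ∀ s t : UnitI, -(s : ℝ) + t ≤ -δ → δ ≤ |(p : ℝ) - q| ∨ δ ≤ |(t : ℝ) - s| := by
    intro s t h
    right; rw [le_abs]; right; linarith
  have c3 : ∀ s t : UnitI, -(s : ℝ) + t ≤ -δ →
      δ ≤ |(p : ℝ) - f q| ∨ δ ≤ (s : ℝ) ∨ (t : ℝ) ≤ 1 - δ := by
    intro s t h
    right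
    by_contra! hc
    linarith [hc.1, hc.2]
  rcases h2 with h2 | h2 | h2
  · exact seg_const f δ k hk p q _ (convexReg (-1) 1 (-δ) 0 0 0 0 0 0)
      (fun s t h => fib_mem f δ p q s t (c1 s t (by simpa using h.1))
        (c3 s t (by simpa using h.1)) (Or.inl h2)) s t tI qI
      ⟨by simp only; linarith, by simp, by simp⟩ ⟨by simp only; linarith, by simp, by simp⟩
  · exact seg_const f δ k hk p q _ (convexReg (-1) 1 (-δ) 0 (-1) (-δ) 0 0 0)
      (fun s t h => fib_mem f δ p q s t (c1 s t (by simpa using h.1))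
        (c3 s t (by simpa using h.1))
        (Or.inr (Or.inl (by simpa using h.2.1)))) s t tI qI
      ⟨by simp only; linarith, by simp only; linarith, by simp⟩
      ⟨by simp only; linarith, by simp only; linarith, by simp⟩
  · exact seg_const f δ k hk p q _ (convexReg (-1) 1 (-δ) 1 0 (1-δ) 0 0 0)
      (fun s t h => fib_mem f δ p q s t (c1 s t (by simpa using h.1))
        (c3 s t (by simpa using h.1))
        (Or.inr (Or.inr (by simpa using h.2.1)))) s t tI qI
      ⟨by simp only; linarith, by simp only; linarith, by simp⟩
      ⟨by simp only; linarith, by simp only; linarith, by simp⟩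

theorem k_const (f : CantorT → CantorT)
    (hwm : ∃ z : CantorT × CantorT, Dense (Set.range fun n : ℕ => (Prod.map f f)^[n] z))
    (hf : Function.Surjective f)
    (δ : ℝ) (hδ : 0 < δ) (hδ' : δ < 1/10)
    (k : Kset f δ → Bool) (hk : Continuous k)
    (hkσ : ∀ x y : Kset f δ, sigmaMap f x = sigmaMap f y → k x = k y) :
    ∃ b, ∀ x, k x = b := by
  have hq : (qI : ℝ) = 1/4 := rfl
  have ht : (tI : ℝ) = 3/4 := rfl
  have hh : (hI : ℝ) = 1/2 := rfl
  have hz : (zI : ℝ) = 0 := rfl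
  have ho : (oI : ℝ) = 1 := rfl
  have mA : ∀ p q, fibPt p q qI tI ∈ Kset f δ := fun p q =>
    fib_A f δ hδ hδ' p q _ _ (by linarith) (by linarith)
  have mB : ∀ p q, fibPt p q tI qI ∈ Kset f δ := fun p q =>
    fib_B f δ hδ hδ' p q _ _ (by linarith) (by linarith)
  have mT : ∀ p q, fibPt p q hI oI ∈ Kset f δ := fun p q =>
    fib_A f δ hδ hδ' p q _ _ (by linarith) (by linarith)
  have mBo : ∀ p q, fibPt p q hI zI ∈ Kset f δ := fun p q =>
    fib_B f δ hδ hδ' p q _ _ (by linarith) (by linarith)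
  have mR : ∀ p q, fibPt p q oI hI ∈ Kset f δ := fun p q => by
    apply fib_mem
    · right; rw [le_abs]; right; linarith
    · right; left; linarith
    · right; left; linarith
  have mL : ∀ p q, fibPt p q zI hI ∈ Kset f δ := fun p q => by
    apply fib_mem
    · right; rw [le_abs]; left; linarith
    · right; right; linarith
    · right; left; linarith
  have glue : ∀ p : CantorT, glueMap f (p, oI) = glueMap f (f p, zI) := fun p =>
    Quot.sound ⟨rfl, rfl, rfl⟩
  have AB : ∀ p q, k ⟨_, mA p q⟩ = k ⟨_, mB p (f q)⟩ := by
    intro p q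
    rw [← upper_const f δ hδ hδ' k hk p q hI oI (mT p q) (mA p q) (Or.inl (by linarith)),
      ← lower_const f δ hδ hδ' k hk p (f q) hI zI (mBo _ _) (mB _ _) (by linarith)]
    apply hkσ
    simp only [sigmaMap, fibPt, Prod.map_apply, glue]
  have BA : ∀ p q, k ⟨_, mB p q⟩ = k ⟨_, mA (f p) q⟩ := by
    intro p q
    rw [← lower_const f δ hδ hδ' k hk p q oI hI (mR p q) (mB p q) (by linarith),
      ← upper_const f δ hδ hδ' k hk (f p) q zI hI (mL _ _) (mA _ _) (Or.inl (by linarith))]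
    apply hkσ
    simp only [sigmaMap, fibPt, Prod.map_apply, glue]
  obtain ⟨z, hzd⟩ := hwm
  have hAc : Continuous (fun w : CantorT × CantorT => k ⟨_, mA w.1 w.2⟩) := by
    apply hk.comp
    apply Continuous.subtype_mk
    unfold fibPt
    fun_prop
  have hA : (fun w : CantorT × CantorT => k ⟨_, mA w.1 w.2⟩) = fun _ => k ⟨_, mA z.1 z.2⟩ := by
    apply Continuous.ext_on hzd hAc continuous_const
    rintro _ ⟨n, rfl⟩
    simp only
    induction n with
    | zero => rfl
    | succ n ih =>
      rw [← ih]
      simp only [Function.iterate_succ_apply', Prod.map_fst, Prod.map_snd]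
      exact ((AB _ _).trans (BA _ _)).symm
  have hA' : ∀ p q, k ⟨_, mA p q⟩ = k ⟨_, mA z.1 z.2⟩ := fun p q => congrFun hA (p, q)
  refine ⟨k ⟨_, mA z.1 z.2⟩, ?_⟩
  rintro ⟨⟨⟨p, s⟩, ⟨q, t⟩⟩, hx⟩
  change k ⟨fibPt p q s t, hx⟩ = _
  by_cases hl : (t : ℝ) + δ ≤ s
  · rw [lower_const f δ hδ hδ' k hk p q s t hx (mB _ _) hl]
    rw [BA, hA']
  · push Not at hl
    rw [upper_const f δ hδ hδ' k hk p q s t hx (mA _ _), hA']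
    by_cases hu : (s : ℝ) + δ ≤ t
    · exact Or.inl hu
    · right
      push Not at hu
      refine ⟨?_, by linarith⟩
      rcases (fib_mem' f δ p q s t hx).1 with h | h
      · exact h
      · rw [le_abs] at h
        rcases h with h | h <;> linarith

theorem isOpen_V0 (f : CantorT → CantorT) (hf : Continuous f) (δ : ℝ) : IsOpen (V0 f δ) := by
  unfold V0 V1 V2 V3
  refine IsOpen.union (IsOpen.union ?_ ?_) ?_
  · apply IsOpen.and <;> exact isOpen_lt (by fun_prop) (by fun_prop)
  · refine IsOpen.and ?_ (IsOpen.and ?_ ?_) <;> exact isOpen_lt (by fun_prop) (by fun_prop)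
  · refine IsOpen.and ?_ (IsOpen.and ?_ ?_) <;> exact isOpen_lt (by fun_prop) (by fun_prop)

theorem sigma_cont (f : CantorT → CantorT) : Continuous (sigmaMap f) := by
  have : Continuous (glueMap f) := continuous_quot_mk
  exact this.prodMap this

/-- If `f` is a homeomorphism of the Cantor set whose orbits and inverse orbits are all
dense and such that `f × f` has a dense orbit, then `σ(K)` is a compact connected subset
of `X²`. -/
theorem sigmaK_compact_connected
    (f : CantorT ≃ₜ CantorT)
    (hmin : ∀ x : CantorT, Dense (Set.range fun n : ℕ => (⇑f)^[n] x))
    (hmin' : ∀ x : CantorT, Dense (Set.range fun n : ℕ => (⇑f.symm)^[n] x))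
    (hwm : ∃ z : CantorT × CantorT, Dense (Set.range fun n : ℕ => (Prod.map ⇑f ⇑f)^[n] z))
    (δ : ℝ) (hδ : 0 < δ) (hδ' : δ < 1/10) :
    IsCompact (sigmaMap ⇑f '' Kset ⇑f δ) ∧ IsConnected (sigmaMap ⇑f '' Kset ⇑f δ) := by
  have hσ := sigma_cont f
  have hcs : CompactSpace CantorT := isCompact_iff_compactSpace.1 isCompact_cantorSet
  refine ⟨(isOpen_V0 f f.continuous δ).isClosed_compl.isCompact.image hσ, ?_, ?_⟩
  · obtain ⟨z, -⟩ := hwm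
    refine Set.Nonempty.image _ ⟨fibPt z.1 z.2 qI tI, fib_A f δ hδ hδ' _ _ _ _ ?_ ?_⟩
    · show (1/4 : ℝ) + 1/2 ≤ 3/4
      norm_num
    · show δ ≤ (1/4 : ℝ)
      linarith
  · rw [isPreconnected_iff_preconnectedSpace]
    apply preconnectedSpace_of_forall_constant
    intro h hh
    let g : Kset f δ → (sigmaMap f '' Kset f δ : Set _) :=
      fun x => ⟨sigmaMap f x, mem_image_of_mem _ x.2⟩
    have hg : Continuous g := Continuous.subtype_mk (hσ.comp continuous_subtype_val) _
    obtain ⟨b, hb⟩ := k_const f hwm f.surjective δ hδ hδ' (h ∘ g) (hh.comp hg) (by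
      intro x y hxy
      exact congrArg h (Subtype.ext hxy))
    have : ∀ x, h x = b := by
      rintro ⟨_, x, hx, rfl⟩
      exact hb ⟨x, hx⟩
    intro x y
    rw [this, this]
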